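/- arXiv:2111.11015 — 7 statements merged into one kernel-verified Lean document; each statement's English description precedes it below -/
import Mathlib

section
/- Let (A,·,α) be a Hom-pre-Lie algebra and (V,β,ρ,μ) a representation of it. Then for every n and every ψ ∈ C^n_α(A;V) one has ∂_{ωα}(∂_{αω}ψ) + ∂_{αα}(∂_{αα}ψ) = 0 as an element of C^{n+2}_α(A;V). -/
open Finset

section

variable (K : Type*) [Field K] (A : Type*) [AddCommGroup A] [Module K A]

/-- A Hom-pre-Lie algebra structure on the `K`-vector space `A`. -/
structure HomPreLie where
  mul : A →ₗ[K] A →ₗ[K] A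
  hom : A →ₗ[K] A
  hom_mul : ∀ x y : A, hom (mul x y) = mul (hom x) (hom y)
  pre_lie : ∀ x y z : A,
    mul (mul x y) (hom z) - mul (hom x) (mul y z)
      = mul (mul y x) (hom z) - mul (hom y) (mul x z)

variable (V : Type*) [AddCommGroup V] [Module K V]

/-- A representation `(V, β, ρ, μ)` of a Hom-pre-Lie algebra `(A, ·, α)`. -/
structure HomPreLieRep (P : HomPreLie K A) where
  β : V →ₗ[K] V
  ρ : A →ₗ[K] V →ₗ[K] V
  μ : A →ₗ[K] V →ₗ[K] V
  β_ρ : ∀ (x : A) (v : V), β (ρ x v) = ρ (P.hom x) (β v)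
  ρ_bracket : ∀ (x y : A) (v : V),
    ρ (P.mul x y - P.mul y x) (β v) = ρ (P.hom x) (ρ y v) - ρ (P.hom y) (ρ x v)
  β_μ : ∀ (x : A) (v : V), β (μ x v) = μ (P.hom x) (β v)
  μ_mul : ∀ (x y : A) (v : V),
    μ (P.hom y) (μ x v) - μ (P.mul x y) (β v) = μ (P.hom y) (ρ x v) - ρ (P.hom x) (μ y v)

/-- An element of `C^{m+1}_ω(A;V)`, i.e. a map `∧^m A ⊗ A → V`: a map which is
multilinear in all `m+1` arguments and alternating in the first `m` of them. -/
structure IsCochain {m : ℕ} (f : (Fin m → A) → A → V) : Prop where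
  map_add : ∀ (x : Fin m → A) (i : Fin m) (a b : A) (z : A),
    f (Function.update x i (a + b)) z
      = f (Function.update x i a) z + f (Function.update x i b) z
  map_smul : ∀ (x : Fin m → A) (i : Fin m) (c : K) (a : A) (z : A),
    f (Function.update x i (c • a)) z = c • f (Function.update x i a) z
  map_add_last : ∀ (x : Fin m → A) (z w : A), f x (z + w) = f x z + f x w
  map_smul_last : ∀ (x : Fin m → A) (c : K) (z : A), f x (c • z) = c • f x z
  alternating : ∀ (x : Fin m → A) (z : A) (i j : Fin m), i ≠ j → x i = x j → f x z = 0

end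

/-- The increasing enumeration of `{0, …, N-1} \ {i, j}` (for `i < j`). -/
def skip2 {N : ℕ} (i j : Fin N) (p : ℕ) : Fin N :=
  ⟨(if p < (i : ℕ) then p else if p + 1 < (j : ℕ) then p + 1 else p + 2) % N,
    Nat.mod_lt _ (Nat.lt_of_le_of_lt (Nat.zero_le _) i.isLt)⟩

section
variable {K : Type*} [Field K] {A : Type*} [AddCommGroup A] [Module K A]
  {V : Type*} [AddCommGroup V] [Module K V]

/-- The operator `∂_{ωω} : C^n_ω(A;V) → C^{n+1}_ω(A;V)` (here `n = m+1`). -/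
def dOmegaOmega (P : HomPreLie K A) (R : HomPreLieRep K A V P) {m : ℕ}
    (f : (Fin m → A) → A → V) : (Fin (m + 1) → A) → A → V :=
  fun x z =>
    (∑ i : Fin (m + 1), (-1 : ℤ) ^ (i : ℕ) •
        R.ρ ((⇑P.hom)^[m] (x i)) (f (x ∘ i.succAbove) z))
    + (∑ i : Fin (m + 1), (-1 : ℤ) ^ (i : ℕ) •
        R.μ ((⇑P.hom)^[m] z) (f (x ∘ i.succAbove) (x i)))
    - (∑ i : Fin (m + 1), (-1 : ℤ) ^ (i : ℕ) •
        f ((fun k => P.hom (x k)) ∘ i.succAbove) (P.mul (x i) z))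
    + (∑ i : Fin (m + 1), ∑ j ∈ Finset.Ioi i, (-1 : ℤ) ^ ((i : ℕ) + (j : ℕ)) •
        f (fun k => if (k : ℕ) = 0 then P.mul (x i) (x j) - P.mul (x j) (x i)
            else P.hom (x (skip2 i j ((k : ℕ) - 1)))) z)

/-- The operator `∂_{ωα} : C^n_ω(A;V) → C^{n+1}_α(A;V)` (here `n = m+1`). -/
def dOmegaAlpha (P : HomPreLie K A) (R : HomPreLieRep K A V P) {m : ℕ}
    (f : (Fin m → A) → A → V) : (Fin m → A) → A → V :=
  fun x z => R.β (f x z) - f (fun k => P.hom (x k)) (P.hom z)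

/-- The operator `∂_{αα} : C^n_α(A;V) → C^{n+1}_α(A;V)` (here `n = q+2`). -/
def dAlphaAlpha (P : HomPreLie K A) (R : HomPreLieRep K A V P) {q : ℕ}
    (g : (Fin q → A) → A → V) : (Fin (q + 1) → A) → A → V :=
  fun x z =>
    (∑ i : Fin (q + 1), (-1 : ℤ) ^ ((i : ℕ) + 1) •
        R.ρ ((⇑P.hom)^[q + 1] (x i)) (g (x ∘ i.succAbove) z))
    + (∑ i : Fin (q + 1), (-1 : ℤ) ^ ((i : ℕ) + 1) •
        R.μ ((⇑P.hom)^[q + 1] z) (g (x ∘ i.succAbove) (x i)))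
    - (∑ i : Fin (q + 1), (-1 : ℤ) ^ ((i : ℕ) + 1) •
        g ((fun k => P.hom (x k)) ∘ i.succAbove) (P.mul (x i) z))
    + (∑ i : Fin (q + 1), ∑ j ∈ Finset.Ioi i, (-1 : ℤ) ^ ((i : ℕ) + (j : ℕ) + 1) •
        g (fun k => if (k : ℕ) = 0 then P.mul (x i) (x j) - P.mul (x j) (x i)
            else P.hom (x (skip2 i j ((k : ℕ) - 1)))) (P.hom z))

/-- The operator `∂_{αω} : C^n_α(A;V) → C^{n+1}_ω(A;V)` (here `n = q+2`). -/
def dAlphaOmega (P : HomPreLie K A) (R : HomPreLieRep K A V P) {q : ℕ}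
    (g : (Fin q → A) → A → V) : (Fin (q + 2) → A) → A → V :=
  fun x z =>
    (∑ i : Fin (q + 2), ∑ j ∈ Finset.Ioi i, (-1 : ℤ) ^ ((i : ℕ) + (j : ℕ)) •
        R.ρ (P.mul ((⇑P.hom)^[q] (x i)) ((⇑P.hom)^[q] (x j))
            - P.mul ((⇑P.hom)^[q] (x j)) ((⇑P.hom)^[q] (x i)))
          (g (fun k => x (skip2 i j (k : ℕ))) z))
    + (∑ i : Fin (q + 2), ∑ j ∈ Finset.Ioi i, (-1 : ℤ) ^ ((i : ℕ) + (j : ℕ)) •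
        R.μ (P.mul ((⇑P.hom)^[q] (x i)) ((⇑P.hom)^[q] z))
          (g (fun k => x (skip2 i j (k : ℕ))) (x j)))
    - (∑ i : Fin (q + 2), ∑ j ∈ Finset.Ioi i, (-1 : ℤ) ^ ((i : ℕ) + (j : ℕ)) •
        R.μ (P.mul ((⇑P.hom)^[q] (x j)) ((⇑P.hom)^[q] z))
          (g (fun k => x (skip2 i j (k : ℕ))) (x i)))

end

section SignedListSums

variable {A B M N : Type*} [AddCommGroup M] [AddCommGroup N]

/-- The signed sum `∑ i, (-1)^i F (l i) (l without l i)` over the entries of a list. -/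
def signedPick : (A → List A → M) → List A → M
  | _, [] => 0
  | F, c :: l => F c l - signedPick (fun a w => F a (c :: w)) l

/-- The signed sum `∑ i < j, (-1)^(i+j+1) G (l i) (l j) (l without l i, l j)`. -/
def signedPickPair : (A → A → List A → M) → List A → M
  | _, [] => 0
  | G, c :: l => signedPick (G c) l + signedPickPair (fun a b w => G a b (c :: w)) l

lemma signedPick_add (F F' : A → List A → M) (l : List A) :
    signedPick (fun a w => F a w + F' a w) l = signedPick F l + signedPick F' l := by
  induction l generalizing F F' with
  | nil => simp [signedPick]
  | cons c l ih => simp only [signedPick, ih]; abel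

lemma signedPickPair_add (G G' : A → A → List A → M) (l : List A) :
    signedPickPair (fun a b w => G a b w + G' a b w) l
      = signedPickPair G l + signedPickPair G' l := by
  induction l generalizing G G' with
  | nil => simp [signedPickPair]
  | cons c l ih => simp only [signedPickPair, ih, signedPick_add]; abel

lemma map_signedPick (T : M →+ N) (F : A → List A → M) (l : List A) :
    T (signedPick F l) = signedPick (fun a w => T (F a w)) l := by
  induction l generalizing F with
  | nil => simp [signedPick]
  | cons c l ih => simp only [signedPick, map_sub, ih]

lemma map_signedPickPair (T : M →+ N) (G : A → A → List A → M) (l : List A) :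
    T (signedPickPair G l) = signedPickPair (fun a b w => T (G a b w)) l := by
  induction l generalizing G with
  | nil => simp [signedPickPair]
  | cons c l ih => simp only [signedPickPair, map_add, ih, map_signedPick]

lemma signedPick_neg (F : A → List A → M) (l : List A) :
    signedPick (fun a w => -F a w) l = -signedPick F l :=
  (map_signedPick (-AddMonoidHom.id M) F l).symm

lemma signedPickPair_neg (G : A → A → List A → M) (l : List A) :
    signedPickPair (fun a b w => -G a b w) l = -signedPickPair G l :=
  (map_signedPickPair (-AddMonoidHom.id M) G l).symm

lemma signedPick_sub (F F' : A → List A → M) (l : List A) :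
    signedPick (fun a w => F a w - F' a w) l = signedPick F l - signedPick F' l := by
  simp only [sub_eq_add_neg, signedPick_add, signedPick_neg]

lemma signedPickPair_sub (G G' : A → A → List A → M) (l : List A) :
    signedPickPair (fun a b w => G a b w - G' a b w) l
      = signedPickPair G l - signedPickPair G' l := by
  simp only [sub_eq_add_neg, signedPickPair_add, signedPickPair_neg]

lemma signedPickPair_zero (l : List A) :
    signedPickPair (fun _ _ _ => (0 : M)) l = 0 := by
  simpa using signedPickPair_sub (fun _ _ _ => (0 : M)) (fun _ _ _ => (0 : M)) l

lemma signedPick_map (φ : A → B) (F : B → List B → M) (l : List A) :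
    signedPick F (l.map φ) = signedPick (fun a w => F (φ a) (w.map φ)) l := by
  induction l generalizing F with
  | nil => simp [signedPick]
  | cons c l ih => simp only [signedPick, List.map_cons, ih]

lemma signedPickPair_map (φ : A → B) (G : B → B → List B → M) (l : List A) :
    signedPickPair G (l.map φ) = signedPickPair (fun a b w => G (φ a) (φ b) (w.map φ)) l := by
  induction l generalizing G with
  | nil => simp [signedPickPair]
  | cons c l ih => simp only [signedPickPair, List.map_cons, ih, signedPick_map]

lemma signedPick_signedPick (G : A → A → List A → M) (l : List A) :
    signedPick (fun a w => signedPick (G a) w) l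
      = signedPickPair (fun a b w => G a b w - G b a w) l := by
  induction l generalizing G with
  | nil => simp [signedPick, signedPickPair]
  | cons c l ih =>
    simp only [signedPick, signedPickPair, signedPick_sub, ih]
    abel

lemma signedPick_signedPickPair (H : A → A → A → List A → M) (l : List A) :
    signedPick (fun e w => signedPickPair (H e) w) l
      = signedPickPair (fun a b w => signedPick (fun e w' => H e a b w') w) l := by
  induction l generalizing H with
  | nil => simp [signedPick, signedPickPair]
  | cons c l ih =>
    simp only [signedPick, signedPickPair, signedPick_add, signedPickPair_sub, ih,
      signedPick_signedPick (fun a b w => H a c b w),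
      signedPick_signedPick (fun b a w => H a c b w)]
    abel

lemma signedPickPair_signedPick_eq_zero (H : A → A → A → List A → M)
    (hH : ∀ a b e w, H a b e w - H a e b w + H b e a w = 0) (l : List A) :
    signedPickPair (fun a b w => signedPick (H a b) w) l = 0 := by
  induction l generalizing H with
  | nil => simp [signedPickPair]
  | cons c l ih =>
    simp only [signedPick, signedPickPair, signedPickPair_sub,
      signedPick_signedPick (fun a b w => H c a b w),
      ih (fun a b e w => H a b e (c :: w)) fun a b e w => hH a b e _]
    rw [sub_zero, ← signedPickPair_sub, ← signedPickPair_add]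
    simp only [hH, signedPickPair_zero]

lemma signedPickPair_signedPickPair_eq_zero (H : A → A → A → A → List A → M)
    (hH : ∀ a b a' b' w, H a b a' b' w + H a' b' a b w = 0) (l : List A) :
    signedPickPair (fun a b w => signedPickPair (H a b) w) l = 0 := by
  induction l generalizing H with
  | nil => simp [signedPickPair]
  | cons c l ih =>
    simp only [signedPickPair, signedPickPair_add, signedPick_signedPickPair (H c),
      ih (fun a b a' b' w => H a b a' b' (c :: w)) fun a b a' b' w => hH a b a' b' _]
    rw [add_zero, ← signedPickPair_add]
    simp only [← signedPick_add, hH]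
    have h0 : ∀ w : List A, signedPick (fun _ _ => (0 : M)) w = 0 := fun w => by
      simpa using signedPick_sub (fun _ _ => (0 : M)) (fun _ _ => (0 : M)) w
    simp only [h0, signedPickPair_zero]

lemma sum_succAbove_eq_signedPick {n : ℕ} (F : A → List A → M) (x : Fin (n + 1) → A) :
    ∑ i : Fin (n + 1), (-1 : ℤ) ^ (i : ℕ) • F (x i) (List.ofFn (x ∘ i.succAbove))
      = signedPick F (List.ofFn x) := by
  induction n generalizing F with
  | zero => simp [signedPick]
  | succ n ih =>
    rw [Fin.sum_univ_succ, List.ofFn_succ (f := x), signedPick,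
      ← ih (fun a w => F a (x 0 :: w)) (fun i => x i.succ), sub_eq_add_neg,
      ← Finset.sum_neg_distrib]
    congr 1
    · simp [Function.comp_def]
    · refine Finset.sum_congr rfl fun i _ => ?_
      simp [List.ofFn_succ, Function.comp_def, pow_succ]

lemma skip2_zero_succ {n : ℕ} (j : Fin (n + 1)) (k : Fin n) :
    skip2 (0 : Fin (n + 2)) j.succ (k : ℕ) = (j.succAbove k).succ := by
  ext
  have := k.isLt
  by_cases h : (k : ℕ) < j
  · rw [Fin.succAbove_of_castSucc_lt _ _ (by simpa [Fin.lt_def] using h)]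
    simp [skip2, h]
  · rw [Fin.succAbove_of_le_castSucc _ _ (by simpa [Fin.le_def] using h)]
    simp [skip2, h]

lemma skip2_succ_succ_zero {n : ℕ} (i j : Fin (n + 1)) :
    skip2 i.succ j.succ 0 = 0 := by
  ext
  simp [skip2]

lemma skip2_succ_succ_succ {n : ℕ} (i j : Fin (n + 2)) (k : Fin n) :
    skip2 i.succ j.succ ((k : ℕ) + 1) = (skip2 i j (k : ℕ)).succ := by
  ext
  have := k.isLt
  simp only [skip2, Fin.val_succ, add_lt_add_iff_right]
  split_ifs <;> rw [Nat.mod_eq_of_lt (by omega), Nat.mod_eq_of_lt (by omega)]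

lemma sum_skip2_eq_signedPickPair {n : ℕ} (G : A → A → List A → M) (x : Fin (n + 2) → A) :
    ∑ i : Fin (n + 2), ∑ j ∈ Finset.Ioi i, (-1 : ℤ) ^ ((i : ℕ) + (j : ℕ) + 1) •
        G (x i) (x j) (List.ofFn fun k : Fin n => x (skip2 i j (k : ℕ)))
      = signedPickPair G (List.ofFn x) := by
  induction n generalizing G with
  | zero =>
    have h0 : Finset.Ioi (0 : Fin 2) = {1} := by decide
    have h1 : Finset.Ioi (1 : Fin 2) = ∅ := by decide
    simp [Fin.sum_univ_two, h0, h1, signedPick, signedPickPair]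
  | succ n ih =>
    rw [Fin.sum_univ_succ, List.ofFn_succ, signedPickPair,
      ← ih (fun a b w => G a b (x 0 :: w)) (fun i => x i.succ),
      ← sum_succAbove_eq_signedPick]
    congr 1
    · rw [Fin.Ioi_zero_eq_map, Finset.sum_map]
      refine Finset.sum_congr rfl fun j _ => ?_
      simp [skip2_zero_succ, Function.comp_def, pow_succ]
    · refine Finset.sum_congr rfl fun i _ => ?_
      rw [← Fin.map_succEmb_Ioi, Finset.sum_map]
      refine Finset.sum_congr rfl fun j _ => ?_
      simp only [List.ofFn_succ, Fin.coe_succEmb, Fin.val_succ, Fin.val_zero,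
        skip2_succ_succ_zero, skip2_succ_succ_succ]
      congr 1
      ring

end SignedListSums

section ListCochains

variable {K : Type*} [Field K] {A : Type*} [AddCommGroup A] [Module K A]
  {V : Type*} [AddCommGroup V] [Module K V] (P : HomPreLie K A) (R : HomPreLieRep K A V P)

/-- The commutator of the product of a Hom-pre-Lie algebra. -/
def HomPreLie.bracket (a b : A) : A := P.mul a b - P.mul b a

lemma HomPreLie.hom_bracket (a b : A) :
    P.hom (P.bracket a b) = P.bracket (P.hom a) (P.hom b) := by
  simp [bracket, P.hom_mul]

lemma HomPreLie.bracket_jacobi (a b e : A) :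
    P.bracket (P.bracket a b) (P.hom e) - P.bracket (P.bracket a e) (P.hom b)
      + P.bracket (P.bracket b e) (P.hom a) = 0 := by
  have h1 := P.pre_lie a b e
  have h2 := P.pre_lie a e b
  have h3 := P.pre_lie b e a
  simp only [bracket, map_sub, LinearMap.sub_apply]
  linear_combination (norm := abel) h1 - h2 + h3

lemma HomPreLie.iterate_hom_mul (n : ℕ) (a b : A) :
    (⇑P.hom)^[n] (P.mul a b) = P.mul ((⇑P.hom)^[n] a) ((⇑P.hom)^[n] b) := by
  induction n with
  | zero => rfl
  | succ n ih => simp only [Function.iterate_succ_apply', ih, P.hom_mul]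

lemma HomPreLie.iterate_hom_sub (n : ℕ) (a b : A) :
    (⇑P.hom)^[n] (a - b) = (⇑P.hom)^[n] a - (⇑P.hom)^[n] b := by
  induction n with
  | zero => rfl
  | succ n ih => simp only [Function.iterate_succ_apply', ih, map_sub]

/-- The summand of `∂_{αα}` attached to a single argument `a`, with twisting power `k`. -/
def actionTerm (k : ℕ) (f : List A → A → V) (a : A) (w : List A) (z : A) : V :=
  R.ρ ((⇑P.hom)^[k] a) (f w z) + R.μ ((⇑P.hom)^[k] z) (f w a)
    - f (w.map P.hom) (P.mul a z)

/-- The operator `∂_{αα}` for cochains on lists of arguments, with twisting power `k`. -/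
def listDAlphaAlpha (k : ℕ) (f : List A → A → V) (l : List A) (z : A) : V :=
  -signedPick (fun a w => actionTerm P R k f a w z) l
    + signedPickPair (fun a b w => f (P.bracket a b :: w.map P.hom) (P.hom z)) l

/-- The summand of `∂_{αω}` attached to a pair of arguments. -/
def pairTerm (q : ℕ) (f : List A → A → V) (a b : A) (w : List A) (z : A) : V :=
  R.ρ (P.bracket ((⇑P.hom)^[q] a) ((⇑P.hom)^[q] b)) (f w z)
    + R.μ (P.mul ((⇑P.hom)^[q] a) ((⇑P.hom)^[q] z)) (f w b)
    - R.μ (P.mul ((⇑P.hom)^[q] b) ((⇑P.hom)^[q] z)) (f w a)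

/-- The operator `∂_{αω}` for cochains on lists of arguments. -/
def listDAlphaOmega (q : ℕ) (f : List A → A → V) (l : List A) (z : A) : V :=
  -signedPickPair (fun a b w => pairTerm P R q f a b w z) l

/-- The composition of two summands of `∂_{αα}`, each attached to a single argument. -/
def actionActionTerm (k : ℕ) (f : List A → A → V) (z a b : A) (w : List A) : V :=
  R.ρ ((⇑P.hom)^[k + 1] a) (actionTerm P R k f b w z)
    + R.μ ((⇑P.hom)^[k + 1] z) (actionTerm P R k f b w a)
    - actionTerm P R k f (P.hom b) (w.map P.hom) (P.mul a z)

/-- The composition of a single-argument summand of `∂_{αα}` with a bracket summand. -/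
def actionBracketTerm (k : ℕ) (f : List A → A → V) (z a b c : A) (w : List A) : V :=
  R.ρ ((⇑P.hom)^[k + 1] a) (f (P.bracket b c :: w.map P.hom) (P.hom z))
    + R.μ ((⇑P.hom)^[k + 1] z) (f (P.bracket b c :: w.map P.hom) (P.hom a))
    - f (P.hom (P.bracket b c) :: (w.map P.hom).map P.hom) (P.hom (P.mul a z))

lemma actionTerm_listDAlphaAlpha (k : ℕ) (f : List A → A → V) (a : A) (w : List A) (z : A) :
    actionTerm P R (k + 1) (listDAlphaAlpha P R k f) a w z
      = -signedPick (actionActionTerm P R k f z a) w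
        + signedPickPair (actionBracketTerm P R k f z a) w := by
  have hΔ : ∀ (v : A) (F : A → List A → V),
      R.ρ v (signedPick F w) = signedPick (fun a w => R.ρ v (F a w)) w :=
    fun v F => map_signedPick (R.ρ v).toAddMonoidHom F w
  have hΔ' : ∀ (v : A) (F : A → List A → V),
      R.μ v (signedPick F w) = signedPick (fun a w => R.μ v (F a w)) w :=
    fun v F => map_signedPick (R.μ v).toAddMonoidHom F w
  have hP : ∀ (v : A) (F : A → A → List A → V),
      R.ρ v (signedPickPair F w) = signedPickPair (fun a b w => R.ρ v (F a b w)) w :=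
    fun v F => map_signedPickPair (R.ρ v).toAddMonoidHom F w
  have hP' : ∀ (v : A) (F : A → A → List A → V),
      R.μ v (signedPickPair F w) = signedPickPair (fun a b w => R.μ v (F a b w)) w :=
    fun v F => map_signedPickPair (R.μ v).toAddMonoidHom F w
  rw [actionTerm]
  simp only [listDAlphaAlpha, map_add, map_neg, hΔ, hΔ', hP, hP', signedPick_map,
    signedPickPair_map]
  unfold actionActionTerm actionBracketTerm
  simp only [signedPick_add, signedPick_sub, signedPickPair_add, signedPickPair_sub,
    P.hom_bracket]
  abel

lemma listDAlphaAlpha_cons_bracket (k : ℕ) (f : List A → A → V) (a b : A) (w : List A) (z : A) :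
    listDAlphaAlpha P R k f (P.bracket a b :: w.map P.hom) (P.hom z)
      = -actionTerm P R k f (P.bracket a b) (w.map P.hom) (P.hom z)
        + signedPick (fun e w' => actionBracketTerm P R k f z e a b w') w
        + signedPick (fun e w' => f (P.bracket (P.bracket a b) (P.hom e)
            :: (w'.map P.hom).map P.hom) (P.hom (P.hom z))) w
        + signedPickPair (fun a' b' w' => f (P.bracket (P.hom a') (P.hom b')
            :: P.hom (P.bracket a b) :: (w'.map P.hom).map P.hom) (P.hom (P.hom z))) w := by
  have h : ∀ e w', actionTerm P R k f (P.hom e) (P.bracket a b :: List.map P.hom w') (P.hom z)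
      = actionBracketTerm P R k f z e a b w' := fun e w' => by
    simp only [actionTerm, actionBracketTerm, P.hom_mul, List.map_cons,
      Function.iterate_succ_apply]
  rw [listDAlphaAlpha]
  simp only [signedPick, signedPickPair, signedPick_map, signedPickPair_map, List.map_cons, h]
  abel

lemma actionActionTerm_sub_actionActionTerm_sub_actionTerm (q : ℕ) (f : List A → A → V)
    (hlast : ∀ w z z', f w (z + z') = f w z + f w z') (a b : A) (w : List A) (z : A) :
    actionActionTerm P R (q + 1) f z a b w - actionActionTerm P R (q + 1) f z b a w
        - actionTerm P R (q + 1) f (P.bracket a b) (w.map P.hom) (P.hom z)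
      = R.β (pairTerm P R q f a b w z)
        - pairTerm P R q f (P.hom a) (P.hom b) (w.map P.hom) (P.hom z) := by
  have hsub : ∀ w z z', f w (z - z') = f w z - f w z' := fun w z z' =>
    eq_sub_of_add_eq (by rw [← hlast, sub_add_cancel])
  have hpre : ∀ w, f w (P.mul (P.mul a b) (P.hom z)) - f w (P.mul (P.hom a) (P.mul b z))
      = f w (P.mul (P.mul b a) (P.hom z)) - f w (P.mul (P.hom b) (P.mul a z)) := fun w => by
    rw [← hsub, ← hsub, P.pre_lie]
  have hc : ∀ c : A, (⇑P.hom)^[q] (P.hom c) = P.hom ((⇑P.hom)^[q] c) := fun c =>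
    (Function.iterate_succ_apply _ _ _).symm.trans (Function.iterate_succ_apply' _ _ _)
  simp only [actionActionTerm, actionTerm, pairTerm, Function.iterate_succ_apply',
    HomPreLie.bracket, P.iterate_hom_mul, P.iterate_hom_sub, hc, map_add, map_sub,
    LinearMap.sub_apply, hsub, R.β_ρ, R.β_μ, P.hom_mul]
  have h1 := R.ρ_bracket (P.hom ((⇑P.hom)^[q] a)) (P.hom ((⇑P.hom)^[q] b)) (f w z)
  have h2 := R.μ_mul (P.hom ((⇑P.hom)^[q] a)) (P.hom ((⇑P.hom)^[q] z)) (f w b)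
  have h3 := R.μ_mul (P.hom ((⇑P.hom)^[q] b)) (P.hom ((⇑P.hom)^[q] z)) (f w a)
  have h4 := hpre ((w.map P.hom).map P.hom)
  simp only [map_sub, LinearMap.sub_apply] at h1
  linear_combination (norm := abel) h4 - h1 + h2 - h3

theorem listDAlphaOmega_add_listDAlphaAlpha_listDAlphaAlpha (q : ℕ) (f : List A → A → V)
    (hlast : ∀ w z z', f w (z + z') = f w z + f w z')
    (hhead : ∀ a b w z, f ((a + b) :: w) z = f (a :: w) z + f (b :: w) z)
    (hswap : ∀ a b w z, f (a :: b :: w) z + f (b :: a :: w) z = 0) (l : List A) (z : A) :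
    R.β (listDAlphaOmega P R q f l z) - listDAlphaOmega P R q f (l.map P.hom) (P.hom z)
      + listDAlphaAlpha P R (q + 2) (listDAlphaAlpha P R (q + 1) f) l z = 0 := by
  have hsub : ∀ a b w z, f ((a - b) :: w) z = f (a :: w) z - f (b :: w) z := fun a b w z =>
    eq_sub_of_add_eq (by rw [← hhead, sub_add_cancel])
  have hzero : ∀ w z, f (0 :: w) z = 0 := fun w z => by simpa using hsub 0 0 w z
  have hjac := signedPickPair_signedPick_eq_zero
    (fun a b e w' => f (P.bracket (P.bracket a b) (P.hom e)
      :: (w'.map P.hom).map P.hom) (P.hom (P.hom z)))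
    (fun a b e w => by
      rw [← hsub, ← hhead, P.bracket_jacobi, hzero]) l
  have hpair := signedPickPair_signedPickPair_eq_zero
    (fun a b a' b' w' => f (P.bracket (P.hom a') (P.hom b')
      :: P.hom (P.bracket a b) :: (w'.map P.hom).map P.hom) (P.hom (P.hom z)))
    (fun a b a' b' w => by
      rw [P.hom_bracket, P.hom_bracket, hswap]) l
  have hβ : R.β (listDAlphaOmega P R q f l z)
      = -signedPickPair (fun a b w => R.β (pairTerm P R q f a b w z)) l := by
    rw [listDAlphaOmega, map_neg]
    exact congrArg Neg.neg (map_signedPickPair R.β.toAddMonoidHom _ l)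
  have hkey : signedPickPair (fun a b w => R.β (pairTerm P R q f a b w z)
        - pairTerm P R q f (P.hom a) (P.hom b) (w.map P.hom) (P.hom z)) l
      = signedPickPair (fun a b w => actionActionTerm P R (q + 1) f z a b w
        - actionActionTerm P R (q + 1) f z b a w
        - actionTerm P R (q + 1) f (P.bracket a b) (w.map P.hom) (P.hom z)) l := by
    simp only [actionActionTerm_sub_actionActionTerm_sub_actionTerm P R q f hlast]
  rw [hβ, listDAlphaOmega, signedPickPair_map, listDAlphaAlpha]
  simp only [actionTerm_listDAlphaAlpha, listDAlphaAlpha_cons_bracket, signedPick_add,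
    signedPick_neg, signedPickPair_add, signedPickPair_neg, hjac, hpair, signedPick_signedPick,
    signedPick_signedPickPair]
  simp only [signedPickPair_sub] at hkey ⊢
  linear_combination (norm := abel) -hkey

lemma dAlphaAlpha_eq_listDAlphaAlpha {q : ℕ} (g : (Fin q → A) → A → V) (f : List A → A → V)
    (hf : ∀ x z, g x z = f (List.ofFn x) z) (x : Fin (q + 1) → A) (z : A) :
    dAlphaAlpha P R g x z = listDAlphaAlpha P R (q + 1) f (List.ofFn x) z := by
  have hmap : ∀ i : Fin (q + 1), List.ofFn ((fun k => P.hom (x k)) ∘ i.succAbove)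
      = (List.ofFn (x ∘ i.succAbove)).map P.hom := fun i => by
    rw [List.map_ofFn]; rfl
  rw [dAlphaAlpha, listDAlphaAlpha]
  congr 1
  · rw [← sum_succAbove_eq_signedPick, ← Finset.sum_add_distrib, ← Finset.sum_sub_distrib,
      ← Finset.sum_neg_distrib]
    refine Finset.sum_congr rfl fun i _ => ?_
    simp only [hf, hmap, actionTerm, pow_succ, mul_neg, mul_one, neg_smul, smul_add, smul_sub]
    abel
  · cases q with
    | zero =>
      simp [signedPick, signedPickPair]
    | succ q =>
      rw [← sum_skip2_eq_signedPickPair]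
      refine Finset.sum_congr rfl fun i _ => Finset.sum_congr rfl fun j _ => ?_
      rw [hf, List.ofFn_succ, List.map_ofFn]
      simp [HomPreLie.bracket, Function.comp_def]

lemma dAlphaOmega_eq_listDAlphaOmega {q : ℕ} (g : (Fin q → A) → A → V) (f : List A → A → V)
    (hf : ∀ x z, g x z = f (List.ofFn x) z) (x : Fin (q + 2) → A) (z : A) :
    dAlphaOmega P R g x z = listDAlphaOmega P R q f (List.ofFn x) z := by
  rw [dAlphaOmega, listDAlphaOmega, ← sum_skip2_eq_signedPickPair, ← Finset.sum_add_distrib,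
    ← Finset.sum_sub_distrib, ← Finset.sum_neg_distrib]
  refine Finset.sum_congr rfl fun i _ => ?_
  rw [← Finset.sum_add_distrib, ← Finset.sum_sub_distrib, ← Finset.sum_neg_distrib]
  refine Finset.sum_congr rfl fun j _ => ?_
  simp only [hf, pairTerm, HomPreLie.bracket, pow_succ _ ((i : ℕ) + (j : ℕ)), mul_neg, mul_one,
    neg_smul, smul_add, smul_sub]
  abel

/-- The extension by zero of a cochain to lists of arguments of arbitrary length. -/
def listCochain {q : ℕ} (g : (Fin q → A) → A → V) (l : List A) (z : A) : V :=
  if l.length = q then g (fun i => l.getD i 0) z else 0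

lemma listCochain_ofFn {q : ℕ} (g : (Fin q → A) → A → V) (x : Fin q → A) (z : A) :
    listCochain g (List.ofFn x) z = g x z := by
  simp [listCochain]

lemma listCochain_add_last {q : ℕ} {g : (Fin q → A) → A → V} (hg : IsCochain K A V g)
    (l : List A) (z z' : A) :
    listCochain g l (z + z') = listCochain g l z + listCochain g l z' := by
  unfold listCochain
  split_ifs
  · exact hg.map_add_last _ _ _
  · simp

lemma listCochain_eq {q : ℕ} (g : (Fin q → A) → A → V) {l : List A} (h : l.length = q) (z : A) :
    listCochain g l z = g (fun i => l.getD i 0) z := if_pos h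

lemma listCochain_of_length_ne {q : ℕ} (g : (Fin q → A) → A → V) {l : List A}
    (h : l.length ≠ q) (z : A) : listCochain g l z = 0 := if_neg h

lemma listCochain_add_head {q : ℕ} {g : (Fin q → A) → A → V} (hg : IsCochain K A V g)
    (a b : A) (w : List A) (z : A) :
    listCochain g ((a + b) :: w) z = listCochain g (a :: w) z + listCochain g (b :: w) z := by
  by_cases h : w.length + 1 = q
  · subst h
    obtain ⟨y, key⟩ : ∃ y, ∀ c : A, (fun i : Fin (w.length + 1) => (c :: w).getD i 0)
        = Function.update y 0 c := by
      refine ⟨fun i => (0 :: w).getD i 0, fun c => funext fun i => ?_⟩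
      refine Fin.cases ?_ (fun j => ?_) i <;> simp
    simp only [listCochain_eq g (List.length_cons (as := w)), key, hg.map_add]
  · simp only [listCochain_of_length_ne g (fun h' => h ((List.length_cons).symm.trans h')),
      add_zero]

lemma listCochain_self_cons_self {q : ℕ} {g : (Fin q → A) → A → V} (hg : IsCochain K A V g)
    (a : A) (w : List A) (z : A) : listCochain g (a :: a :: w) z = 0 := by
  by_cases h : w.length + 2 = q
  · subst h
    rw [listCochain_eq g (by simp)]
    exact hg.alternating _ _ 0 1 (by simp) (by simp)
  · exact listCochain_of_length_ne g (by simpa using h) z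

lemma listCochain_add_second {q : ℕ} {g : (Fin q → A) → A → V} (hg : IsCochain K A V g)
    (c a b : A) (w : List A) (z : A) :
    listCochain g (c :: (a + b) :: w) z
      = listCochain g (c :: a :: w) z + listCochain g (c :: b :: w) z := by
  by_cases h : w.length + 2 = q
  · subst h
    obtain ⟨y, key⟩ : ∃ y, ∀ d : A, (fun i : Fin (w.length + 2) => (c :: d :: w).getD i 0)
        = Function.update y 1 d := by
      refine ⟨fun i => (c :: 0 :: w).getD i 0, fun d => funext fun i => ?_⟩
      refine Fin.cases ?_ (fun j => Fin.cases ?_ (fun k => ?_) j) i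
      · simp
      · simp
      · rw [Function.update_of_ne (by simp [Fin.ext_iff])]; simp
    have hl : ∀ d : A, (c :: d :: w).length = w.length + 2 := fun d => by simp
    simp only [listCochain_eq g (hl _), key, hg.map_add]
  · have hl : ∀ d : A, (c :: d :: w).length ≠ q := fun d => by simpa using h
    simp only [listCochain_of_length_ne g (hl _), add_zero]

lemma listCochain_swap {q : ℕ} {g : (Fin q → A) → A → V} (hg : IsCochain K A V g)
    (a b : A) (w : List A) (z : A) :
    listCochain g (a :: b :: w) z + listCochain g (b :: a :: w) z = 0 := by
  have h := listCochain_self_cons_self hg (a + b) w z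
  rw [listCochain_add_head hg, listCochain_add_second hg, listCochain_add_second hg,
    listCochain_self_cons_self hg, listCochain_self_cons_self hg] at h
  simpa using h

end ListCochains

/-- Lemma 2.9, fourth identity: `∂_{ωα} ∘ ∂_{αω} + ∂_{αα} ∘ ∂_{αα} = 0`
on `C^n_α(A;V)` (with `n = q+2`). -/
theorem dOmegaAlpha_dAlphaOmega_add_dAlphaAlpha_dAlphaAlpha_eq_zero
    (K : Type*) [Field K] (A : Type*) [AddCommGroup A] [Module K A]
    (V : Type*) [AddCommGroup V] [Module K V]
    (P : HomPreLie K A) (R : HomPreLieRep K A V P) (q : ℕ)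
    (g : (Fin q → A) → A → V) (hg : IsCochain K A V g) :
    ∀ (x : Fin (q + 2) → A) (z : A),
      dOmegaAlpha P R (dAlphaOmega P R g) x z
        + dAlphaAlpha P R (dAlphaAlpha P R g) x z = 0 := by
  intro x z
  have hf : ∀ y v, g y v = listCochain g (List.ofFn y) v := fun y v =>
    (listCochain_ofFn g y v).symm
  rw [dOmegaAlpha, dAlphaOmega_eq_listDAlphaOmega P R g _ hf,
    dAlphaOmega_eq_listDAlphaOmega P R g _ hf,
    dAlphaAlpha_eq_listDAlphaAlpha P R (dAlphaAlpha P R g) _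
      (dAlphaAlpha_eq_listDAlphaAlpha P R g _ hf),
    show List.ofFn (fun k => P.hom (x k)) = (List.ofFn x).map P.hom by
      rw [List.map_ofFn]; rfl]
  exact listDAlphaOmega_add_listDAlphaAlpha_listDAlphaAlpha P R q _
    (listCochain_add_last hg) (listCochain_add_head hg) (listCochain_swap hg) _ z
end

section
/- Let (Â,·_Â,α_Â) be an abelian extension of a Hom-pre-Lie algebra (A,·,α) by (V,β), with maps ι : V → Â, p : Â → A, and let s : A → Â be a section (p∘s = Id_A). Identifying V with ι(V) = ker p ⊆ Â, define ρ,μ : A → gl(V) by ρ(x)(u) = s(x)·_Â u and μ(x)(u) = u·_Â s(x) for x ∈ A, u ∈ V. Then ρ(x)(u) and μ(x)(u) lie in V, and (V,β,ρ,μ) is a representation of (A,·,α): for all x,y ∈ A, β∘ρ(x) = ρ(α(x))∘β, ρ([x,y]_C)∘β = ρ(α(x))∘ρ(y) − ρ(α(y))∘ρ(x), β∘μ(x) = μ(α(x))∘β, and μ(α(y))∘μ(x) − μ(x·y)∘β = μ(α(y))∘ρ(x) − ρ(α(x))∘μ(y), where [x,y]_C = x·y − y·x. -/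
/-- Theorem 4.4 (i): given an abelian extension
`0 → V → Â → A → 0` of a Hom-pre-Lie algebra `(A,·,α)` by `(V,β)` and a
section `s : A → Â`, the operations `ρ(x)(u) = s(x)·u` and `μ(x)(u) = u·s(x)`
take values in `V` (identified with `ι(V) = ker p ⊆ Â`) and define a
representation `(V, β, ρ, μ)` of `(A,·,α)` (all identities are stated in `Â`
through the identification `ι`). -/
theorem abelian_extension_induces_representation
    (K : Type*) [Field K] (A : Type*) [AddCommGroup A] [Module K A]
    (V : Type*) [AddCommGroup V] [Module K V]
    (Ahat : Type*) [AddCommGroup Ahat] [Module K Ahat]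
    (P : HomPreLie K A) (Ph : HomPreLie K Ahat)
    (β : V →ₗ[K] V) (ι : V →ₗ[K] Ahat) (p : Ahat →ₗ[K] A)
    -- `ι` is a morphism from the abelian Hom-pre-Lie algebra `(V, 0, β)`:
    (hι_mul : ∀ u v : V, Ph.mul (ι u) (ι v) = 0)
    (hι_hom : ∀ u : V, Ph.hom (ι u) = ι (β u))
    -- `p` is a morphism of Hom-pre-Lie algebras:
    (hp_mul : ∀ a b : Ahat, p (Ph.mul a b) = P.mul (p a) (p b))
    (hp_hom : ∀ a : Ahat, p (Ph.hom a) = P.hom (p a))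
    -- short exactness:
    (hι_inj : Function.Injective ι) (hp_surj : Function.Surjective p)
    (hexact : ∀ a : Ahat, p a = 0 ↔ a ∈ Set.range ι)
    -- a section of `p`:
    (s : A →ₗ[K] Ahat) (hs : ∀ x : A, p (s x) = x) :
    -- `ρ(x)(u) = s(x)·u` and `μ(x)(u) = u·s(x)` take values in `V`:
    (∀ (x : A) (u : V), Ph.mul (s x) (ι u) ∈ Set.range ι)
    ∧ (∀ (x : A) (u : V), Ph.mul (ι u) (s x) ∈ Set.range ι)
    -- `β ∘ ρ(x) = ρ(α(x)) ∘ β`: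
    ∧ (∀ (x : A) (u : V),
        Ph.hom (Ph.mul (s x) (ι u)) = Ph.mul (s (P.hom x)) (ι (β u)))
    -- `ρ([x,y]_C) ∘ β = ρ(α(x)) ∘ ρ(y) - ρ(α(y)) ∘ ρ(x)`:
    ∧ (∀ (x y : A) (u : V),
        Ph.mul (s (P.mul x y - P.mul y x)) (ι (β u))
          = Ph.mul (s (P.hom x)) (Ph.mul (s y) (ι u))
            - Ph.mul (s (P.hom y)) (Ph.mul (s x) (ι u)))
    -- `β ∘ μ(x) = μ(α(x)) ∘ β`:
    ∧ (∀ (x : A) (u : V),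
        Ph.hom (Ph.mul (ι u) (s x)) = Ph.mul (ι (β u)) (s (P.hom x)))
    -- `μ(α(y)) ∘ μ(x) - μ(x·y) ∘ β = μ(α(y)) ∘ ρ(x) - ρ(α(x)) ∘ μ(y)`:
    ∧ (∀ (x y : A) (u : V),
        Ph.mul (Ph.mul (ι u) (s x)) (s (P.hom y))
            - Ph.mul (ι (β u)) (s (P.mul x y))
          = Ph.mul (Ph.mul (s x) (ι u)) (s (P.hom y))
            - Ph.mul (s (P.hom x)) (Ph.mul (ι u) (s y))) := by
  have hker {w : Ahat} (hw : p w = 0) : ∃ u, ι u = w := (hexact w).1 hw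
  have hpι (u : V) : p (ι u) = 0 := (hexact _).2 ⟨u, rfl⟩
  have hpl (x : A) (u : V) : p (Ph.mul (s x) (ι u)) = 0 := by simp [hp_mul, hpι]
  have hpr (x : A) (u : V) : p (Ph.mul (ι u) (s x)) = 0 := by simp [hp_mul, hpι]
  -- The action of `Ahat` on `ker p` depends only on the image in `A`.
  have left_congr {a b w : Ahat} (hab : p a = p b) (hw : p w = 0) :
      Ph.mul a w = Ph.mul b w := by
    obtain ⟨u, rfl⟩ := hker hw
    obtain ⟨v, hv⟩ := hker (w := a - b) (by rw [map_sub, hab, sub_self])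
    rw [← sub_eq_zero, ← LinearMap.sub_apply, ← map_sub, ← hv, hι_mul]
  have right_congr {a b w : Ahat} (hab : p a = p b) (hw : p w = 0) :
      Ph.mul w a = Ph.mul w b := by
    obtain ⟨u, rfl⟩ := hker hw
    obtain ⟨v, hv⟩ := hker (w := a - b) (by rw [map_sub, hab, sub_self])
    rw [← sub_eq_zero, ← map_sub, ← hv, hι_mul]
  have hs_hom (x : A) : p (s (P.hom x)) = p (Ph.hom (s x)) := by rw [hs, hp_hom, hs]
  have hs_mul (x y : A) : p (s (P.mul x y)) = p (Ph.mul (s x) (s y)) := by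
    rw [hs, hp_mul, hs, hs]
  refine ⟨fun x u => hker (hpl x u), fun x u => hker (hpr x u), fun x u => ?_,
    fun x y u => ?_, fun x u => ?_, fun x y u => ?_⟩
  · rw [Ph.hom_mul, hι_hom, left_congr (hs_hom x) (hpι _)]
  · have h := Ph.pre_lie (s x) (s y) (ι u)
    rw [hι_hom] at h
    rw [map_sub, map_sub, LinearMap.sub_apply, left_congr (hs_mul x y) (hpι _),
      left_congr (hs_mul y x) (hpι _), left_congr (hs_hom x) (hpl y u),
      left_congr (hs_hom y) (hpl x u), sub_eq_sub_iff_sub_eq_sub]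
    exact h
  · rw [Ph.hom_mul, hι_hom, right_congr (hs_hom x) (hpι _)]
  · have h := Ph.pre_lie (ι u) (s x) (s y)
    rw [hι_hom] at h
    rw [right_congr (hs_hom y) (hpr x u), right_congr (hs_mul x y) (hpι _),
      right_congr (hs_hom y) (hpl x u), left_congr (hs_hom x) (hpr y u)]
    exact h
end

section
/- Let (Â,·_Â,α_Â) be an abelian extension of a Hom-pre-Lie algebra (A,·,α) by (V,β), let s : A → Â be a section, and let (V,β,ρ,μ) be the induced representation (ρ(x)(u) = s(x)·_Â u, μ(x)(u) = u·_Â s(x)). Define θ : A×A → V and ξ : A → V by θ(x,y) = s(x)·_Â s(y) − s(x·y) and ξ(x) = α_Â(s(x)) − s(α(x)). Then (θ,ξ) is a 2-cocycle of (A,·,α) with coefficients in (V,β,ρ,μ): for all x,y,z ∈ A, ρ(α(x))θ(y,z) − ρ(α(y))θ(x,z) + μ(α(z))θ(y,x) − μ(α(z))θ(x,y) + θ(α(x),y·z) − θ(α(y),x·z) − θ([x,y]_C,α(z)) − ρ([x,y]_C)ξ(z) − μ(x·z)ξ(y) + μ(y·z)ξ(x) = 0, and β(θ(x,y)) − θ(α(x),α(y))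 − ρ(α(x))ξ(y) − μ(α(y))ξ(x) + ξ(x·y) = 0, where [x,y]_C = x·y − y·x. -/
/-- Theorem 4.4 (ii): given an abelian extension `0 → V → Â → A → 0` of a
Hom-pre-Lie algebra `(A,·,α)` by `(V,β)` and a section `s : A → Â`, the pair
`(θ, ξ)` defined by `θ(x,y) = s(x)·s(y) - s(x·y)` and
`ξ(x) = α_Â(s(x)) - s(α(x))` takes values in `V` (identified with
`ι(V) = ker p ⊆ Â`) and is a 2-cocycle with coefficients in the induced
representation (all identities are stated in `Â` through `ι`). -/
theorem abelian_extension_two_cocycle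
    (K : Type*) [Field K] (A : Type*) [AddCommGroup A] [Module K A]
    (V : Type*) [AddCommGroup V] [Module K V]
    (Ahat : Type*) [AddCommGroup Ahat] [Module K Ahat]
    (P : HomPreLie K A) (Ph : HomPreLie K Ahat)
    (β : V →ₗ[K] V) (ι : V →ₗ[K] Ahat) (p : Ahat →ₗ[K] A)
    (hι_mul : ∀ u v : V, Ph.mul (ι u) (ι v) = 0)
    (hι_hom : ∀ u : V, Ph.hom (ι u) = ι (β u))
    (hp_mul : ∀ a b : Ahat, p (Ph.mul a b) = P.mul (p a) (p b))
    (hp_hom : ∀ a : Ahat, p (Ph.hom a) = P.hom (p a))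
    (hι_inj : Function.Injective ι) (hp_surj : Function.Surjective p)
    (hexact : ∀ a : Ahat, p a = 0 ↔ a ∈ Set.range ι)
    (s : A →ₗ[K] Ahat) (hs : ∀ x : A, p (s x) = x) :
    let θ : A → A → Ahat := fun x y => Ph.mul (s x) (s y) - s (P.mul x y)
    let ξ : A → Ahat := fun x => Ph.hom (s x) - s (P.hom x)
    -- `θ` and `ξ` take values in `V`:
    (∀ x y : A, θ x y ∈ Set.range ι)
    ∧ (∀ x : A, ξ x ∈ Set.range ι)
    -- the first 2-cocycle identity
    -- `ρ(α(x))θ(y,z) - ρ(α(y))θ(x,z) + μ(α(z))θ(y,x) - μ(α(z))θ(x,y)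
    --   + θ(α(x),y·z) - θ(α(y),x·z) - θ([x,y]_C,α(z)) - ρ([x,y]_C)ξ(z)
    --   - μ(x·z)ξ(y) + μ(y·z)ξ(x) = 0`:
    ∧ (∀ x y z : A,
        Ph.mul (s (P.hom x)) (θ y z) - Ph.mul (s (P.hom y)) (θ x z)
          + Ph.mul (θ y x) (s (P.hom z)) - Ph.mul (θ x y) (s (P.hom z))
          + θ (P.hom x) (P.mul y z) - θ (P.hom y) (P.mul x z)
          - θ (P.mul x y - P.mul y x) (P.hom z)
          - Ph.mul (s (P.mul x y - P.mul y x)) (ξ z)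
          - Ph.mul (ξ y) (s (P.mul x z)) + Ph.mul (ξ x) (s (P.mul y z)) = 0)
    -- the second 2-cocycle identity
    -- `β(θ(x,y)) - θ(α(x),α(y)) - ρ(α(x))ξ(y) - μ(α(y))ξ(x) + ξ(x·y) = 0`:
    ∧ (∀ x y : A,
        Ph.hom (θ x y) - θ (P.hom x) (P.hom y)
          - Ph.mul (s (P.hom x)) (ξ y) - Ph.mul (ξ x) (s (P.hom y))
          + ξ (P.mul x y) = 0) := by
  intro θ ξ
  have hθ : ∀ x y : A, θ x y ∈ Set.range ι := fun x y =>
    (hexact _).1 (by simp only [θ, map_sub, hp_mul, hs, sub_self])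
  have hξ : ∀ x : A, ξ x ∈ Set.range ι := fun x =>
    (hexact _).1 (by simp only [ξ, map_sub, hp_hom, hs, sub_self])
  have mul_range : ∀ a ∈ Set.range ι, ∀ b ∈ Set.range ι, Ph.mul a b = 0 := by
    rintro _ ⟨u, rfl⟩ _ ⟨v, rfl⟩
    exact hι_mul u v
  refine ⟨hθ, hξ, fun x y z => ?_, fun x y => ?_⟩
  · have hxy := mul_range _ (hθ x y) _ (hξ z)
    have hyx := mul_range _ (hθ y x) _ (hξ z)
    have hx := mul_range _ (hξ x) _ (hθ y z)
    have hy := mul_range _ (hξ y) _ (hθ x z)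
    have hhat := Ph.pre_lie (s x) (s y) (s z)
    have hbase := congrArg s (P.pre_lie x y z)
    simp only [θ, ξ, map_sub, LinearMap.sub_apply] at hxy hyx hx hy hbase ⊢
    linear_combination (norm := abel) hxy - hyx - hx + hy - hhat + hbase
  · have h := mul_range _ (hξ x) _ (hξ y)
    have hhat := Ph.hom_mul (s x) (s y)
    have hbase := congrArg s (P.hom_mul x y)
    simp only [θ, ξ, map_sub, LinearMap.sub_apply] at h ⊢
    linear_combination (norm := abel) h + hhat - hbase
end

section
/- Let (Â_1,·_1,α_1) and (Â_2,·_2,α_2) be two isomorphic abelian extensions of a Hom-pre-Lie algebra (A,·,α) by (V,β), with isomorphism ζ : Â_1 → Â_2. Then the two extensions give rise to the same representation of (A,·,α) on V: if s_2 : A → Â_2 is a section of Â_2, then s_1' := ζ^{-1}∘s_2 is a section of Â_1, and for all x ∈ A, u ∈ V one has s_1'(x)·_1 u = s_2(x)·_2 u and u·_1 s_1'(x) = u·_2 s_2(x); hence the representations induced by any sections of the two extensions coincide. -/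
/-- Proposition 4.6 (ii): isomorphic abelian extensions of a Hom-pre-Lie
algebra `(A,·,α)` by `(V,β)` give rise to the same representation of
`(A,·,α)` on `V`: if `s₂` is a section of the second extension then
`s₁' := ζ⁻¹ ∘ s₂` is a section of the first one inducing the same
representation, and consequently the representations induced by arbitrary
sections of the two extensions coincide (identities are stated in the total
spaces through the identifications `ι₁`, `ι₂` and `ζ`). -/
theorem isomorphic_extensions_same_representation
    (K : Type*) [Field K] (A : Type*) [AddCommGroup A] [Module K A]
    (V : Type*) [AddCommGroup V] [Module K V]
    (Ahat₁ : Type*) [AddCommGroup Ahat₁] [Module K Ahat₁]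
    (Ahat₂ : Type*) [AddCommGroup Ahat₂] [Module K Ahat₂]
    (P : HomPreLie K A) (Ph₁ : HomPreLie K Ahat₁) (Ph₂ : HomPreLie K Ahat₂)
    (β : V →ₗ[K] V)
    (ι₁ : V →ₗ[K] Ahat₁) (p₁ : Ahat₁ →ₗ[K] A)
    (ι₂ : V →ₗ[K] Ahat₂) (p₂ : Ahat₂ →ₗ[K] A)
    -- the first abelian extension:
    (hι₁_mul : ∀ u v : V, Ph₁.mul (ι₁ u) (ι₁ v) = 0)
    (hι₁_hom : ∀ u : V, Ph₁.hom (ι₁ u) = ι₁ (β u))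
    (hp₁_mul : ∀ a b : Ahat₁, p₁ (Ph₁.mul a b) = P.mul (p₁ a) (p₁ b))
    (hp₁_hom : ∀ a : Ahat₁, p₁ (Ph₁.hom a) = P.hom (p₁ a))
    (hι₁_inj : Function.Injective ι₁) (hp₁_surj : Function.Surjective p₁)
    (hexact₁ : ∀ a : Ahat₁, p₁ a = 0 ↔ a ∈ Set.range ι₁)
    -- the second abelian extension:
    (hι₂_mul : ∀ u v : V, Ph₂.mul (ι₂ u) (ι₂ v) = 0)
    (hι₂_hom : ∀ u : V, Ph₂.hom (ι₂ u) = ι₂ (β u))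
    (hp₂_mul : ∀ a b : Ahat₂, p₂ (Ph₂.mul a b) = P.mul (p₂ a) (p₂ b))
    (hp₂_hom : ∀ a : Ahat₂, p₂ (Ph₂.hom a) = P.hom (p₂ a))
    (hι₂_inj : Function.Injective ι₂) (hp₂_surj : Function.Surjective p₂)
    (hexact₂ : ∀ a : Ahat₂, p₂ a = 0 ↔ a ∈ Set.range ι₂)
    -- an isomorphism of abelian extensions:
    (ζ : Ahat₁ ≃ₗ[K] Ahat₂)
    (hζ_mul : ∀ a b : Ahat₁, ζ (Ph₁.mul a b) = Ph₂.mul (ζ a) (ζ b))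
    (hζ_hom : ∀ a : Ahat₁, ζ (Ph₁.hom a) = Ph₂.hom (ζ a))
    (hζι : ∀ u : V, ζ (ι₁ u) = ι₂ u)
    (hpζ : ∀ a : Ahat₁, p₂ (ζ a) = p₁ a)
    -- a section of the second extension:
    (s₂ : A →ₗ[K] Ahat₂) (hs₂ : ∀ x : A, p₂ (s₂ x) = x) :
    -- `s₁' := ζ⁻¹ ∘ s₂` is a section of the first extension:
    (∀ x : A, p₁ (ζ.symm (s₂ x)) = x)
    -- it induces the same representation as `s₂`:
    ∧ (∀ (x : A) (u : V),
        ζ (Ph₁.mul (ζ.symm (s₂ x)) (ι₁ u)) = Ph₂.mul (s₂ x) (ι₂ u))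
    ∧ (∀ (x : A) (u : V),
        ζ (Ph₁.mul (ι₁ u) (ζ.symm (s₂ x))) = Ph₂.mul (ι₂ u) (s₂ x))
    -- hence any sections of the two extensions induce the same representation:
    ∧ (∀ s₁ : A →ₗ[K] Ahat₁, (∀ x : A, p₁ (s₁ x) = x) →
        (∀ (x : A) (u : V),
          ζ (Ph₁.mul (s₁ x) (ι₁ u)) = Ph₂.mul (s₂ x) (ι₂ u))
        ∧ (∀ (x : A) (u : V),
          ζ (Ph₁.mul (ι₁ u) (s₁ x)) = Ph₂.mul (ι₂ u) (s₂ x))) := by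
  have hsymm (x : A) : p₁ (ζ.symm (s₂ x)) = x := by
    rw [← hpζ, ζ.apply_symm_apply, hs₂]
  have hdiff (s₁ : A →ₗ[K] Ahat₁) (hs₁ : ∀ x : A, p₁ (s₁ x) = x) (x : A) :
      ∃ v : V, ζ (s₁ x) = s₂ x + ι₂ v := by
    obtain ⟨v, hv⟩ := (hexact₂ (ζ (s₁ x) - s₂ x)).1 (by rw [map_sub, hpζ, hs₁, hs₂, sub_self])
    exact ⟨v, by rw [hv, add_sub_cancel]⟩
  refine ⟨hsymm, fun x u ↦ ?_, fun x u ↦ ?_, fun s₁ hs₁ ↦ ⟨fun x u ↦ ?_, fun x u ↦ ?_⟩⟩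
  · rw [hζ_mul, hζι, ζ.apply_symm_apply]
  · rw [hζ_mul, hζι, ζ.apply_symm_apply]
  · obtain ⟨v, hv⟩ := hdiff s₁ hs₁ x
    rw [hζ_mul, hζι, hv, map_add, LinearMap.add_apply, hι₂_mul, add_zero]
  · obtain ⟨v, hv⟩ := hdiff s₁ hs₁ x
    rw [hζ_mul, hζι, hv, map_add, hι₂_mul, add_zero]
end

section
/- Let (Â,·_Â,α_Â) be an abelian extension of a Hom-pre-Lie algebra (A,·,α) by (V,β), and let s_1, s_2 : A → Â be two sections, with associated 2-cocycles (θ_1,ξ_1) and (θ_2,ξ_2) (θ_i(x,y) = s_i(x)·_Â s_i(y) − s_i(x·y), ξ_i(x) = α_Â(s_i(x)) − s_i(α(x))). Then (θ_1,ξ_1) and (θ_2,ξ_2) differ by a 2-coboundary: with φ := s_1 − s_2 : A → V, for all x,y ∈ A one has θ_1(x,y) − θ_2(x,y) = ρ(x)φ(y) + μ(y)φ(x) − φ(x·y) and ξ_1(x) − ξ_2(x) = β(φ(x)) − φ(α(x)), where (V,β,ρ,μ) is the induced representation (ρ(x)(u) = s_2(x)·_Â u, μ(x)(u) = u·_Â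 s_2(x)). -/
/-- The 2-cocycles associated to two different sections `s₁, s₂` of an abelian
extension of a Hom-pre-Lie algebra `(A,·,α)` by `(V,β)` differ by the
2-coboundary of `φ := s₁ - s₂` (which takes values in `V`); the identities are
stated inside `Â` through the identification `ι`, the induced representation
being `ρ(x)(u) = s₂(x)·u`, `μ(x)(u) = u·s₂(x)`. -/
theorem cocycles_of_sections_differ_by_coboundary
    (K : Type*) [Field K] (A : Type*) [AddCommGroup A] [Module K A]
    (V : Type*) [AddCommGroup V] [Module K V]
    (Ahat : Type*) [AddCommGroup Ahat] [Module K Ahat]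
    (P : HomPreLie K A) (Ph : HomPreLie K Ahat)
    (β : V →ₗ[K] V) (ι : V →ₗ[K] Ahat) (p : Ahat →ₗ[K] A)
    (hι_mul : ∀ u v : V, Ph.mul (ι u) (ι v) = 0)
    (hι_hom : ∀ u : V, Ph.hom (ι u) = ι (β u))
    (hp_mul : ∀ a b : Ahat, p (Ph.mul a b) = P.mul (p a) (p b))
    (hp_hom : ∀ a : Ahat, p (Ph.hom a) = P.hom (p a))
    (hι_inj : Function.Injective ι) (hp_surj : Function.Surjective p)
    (hexact : ∀ a : Ahat, p a = 0 ↔ a ∈ Set.range ι)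
    (s₁ s₂ : A →ₗ[K] Ahat) (hs₁ : ∀ x : A, p (s₁ x) = x)
    (hs₂ : ∀ x : A, p (s₂ x) = x) :
    let θ₁ : A → A → Ahat := fun x y => Ph.mul (s₁ x) (s₁ y) - s₁ (P.mul x y)
    let ξ₁ : A → Ahat := fun x => Ph.hom (s₁ x) - s₁ (P.hom x)
    let θ₂ : A → A → Ahat := fun x y => Ph.mul (s₂ x) (s₂ y) - s₂ (P.mul x y)
    let ξ₂ : A → Ahat := fun x => Ph.hom (s₂ x) - s₂ (P.hom x)
    let φ : A → Ahat := fun x => s₁ x - s₂ x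
    -- `φ` takes values in `V`:
    (∀ x : A, φ x ∈ Set.range ι)
    -- `θ₁ - θ₂ = ∂_{ωω} φ`, i.e. `θ₁(x,y) - θ₂(x,y) = ρ(x)φ(y) + μ(y)φ(x) - φ(x·y)`:
    ∧ (∀ x y : A,
        θ₁ x y - θ₂ x y
          = Ph.mul (s₂ x) (φ y) + Ph.mul (φ x) (s₂ y) - φ (P.mul x y))
    -- `ξ₁ - ξ₂ = ∂_{ωα} φ`, i.e. `ξ₁(x) - ξ₂(x) = β(φ(x)) - φ(α(x))`:
    ∧ (∀ x : A, ξ₁ x - ξ₂ x = Ph.hom (φ x) - φ (P.hom x)) := by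
  intro θ₁ ξ₁ θ₂ ξ₂ φ
  have hφ : ∀ x : A, φ x ∈ Set.range ι := fun x =>
    (hexact _).1 (by simp [φ, hs₁, hs₂])
  refine ⟨hφ, fun x y => ?_, fun x => ?_⟩
  · have hφφ : Ph.mul (φ x) (φ y) = 0 := by
      obtain ⟨u, hu⟩ := hφ x
      obtain ⟨v, hv⟩ := hφ y
      rw [← hu, ← hv, hι_mul]
    simp only [θ₁, θ₂, φ, map_sub, LinearMap.sub_apply] at hφφ ⊢
    rw [← sub_eq_zero, ← hφφ]
    abel
  · simp only [ξ₁, ξ₂, φ, map_sub]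
    abel
end

section
/- Let (A,·,α) be a Hom-pre-Lie algebra, (V,β,ρ,μ) a representation of it, and (θ,ξ) a 2-cocycle of (A,·,α) with coefficients in (V,β,ρ,μ). Then the operations on A ⊕ V defined by (x+u) ⋄ (y+v) = x·y + θ(x,y) + ρ(x)(v) + μ(y)(u) and φ(x+u) = α(x) + ξ(x) + β(u) make (A ⊕ V, ⋄, φ) a Hom-pre-Lie algebra, and it is an abelian extension of (A,·,α) by (V,β) with ι the inclusion of V and p the projection onto A. -/
/-- The product `(x+u) ⋄ (y+v) = x·y + θ(x,y) + ρ(x)(v) + μ(y)(u)` on `A × V`. -/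
def HomPreLieRep.extMul {K A V : Type*} [Field K] [AddCommGroup A] [Module K A]
    [AddCommGroup V] [Module K V] {P : HomPreLie K A} (R : HomPreLieRep K A V P)
    (θ : A →ₗ[K] A →ₗ[K] V) : A × V →ₗ[K] A × V →ₗ[K] A × V :=
  LinearMap.mk₂ K
    (fun a b => (P.mul a.1 b.1, θ a.1 b.1 + R.ρ a.1 b.2 + R.μ b.1 a.2))
    (fun a b c => by ext <;> simp; abel)
    (fun k a b => by ext <;> simp)
    (fun a b c => by ext <;> simp; abel)
    (fun k a b => by ext <;> simp)

/-- The structure map `φ(x+u) = α(x) + ξ(x) + β(u)` on `A × V`. -/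
def HomPreLieRep.extHom {K A V : Type*} [Field K] [AddCommGroup A] [Module K A]
    [AddCommGroup V] [Module K V] {P : HomPreLie K A} (R : HomPreLieRep K A V P)
    (ξ : A →ₗ[K] V) : A × V →ₗ[K] A × V :=
  (P.hom ∘ₗ LinearMap.fst K A V).prod (ξ.coprod R.β)

/-- Given a representation `(V,β,ρ,μ)` of a Hom-pre-Lie algebra `(A,·,α)` and
a 2-cocycle `(θ,ξ)` with coefficients in it, the operations
`(x+u) ⋄ (y+v) = x·y + θ(x,y) + ρ(x)(v) + μ(y)(u)` and
`φ(x+u) = α(x) + ξ(x) + β(u)` make `A ⊕ V` into a Hom-pre-Lie algebra, which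
is an abelian extension of `(A,·,α)` by `(V,β)`, with `ι` the inclusion of
`V` and `p` the projection onto `A`. -/
theorem two_cocycle_gives_abelian_extension
    (K : Type*) [Field K] (A : Type*) [AddCommGroup A] [Module K A]
    (V : Type*) [AddCommGroup V] [Module K V]
    (P : HomPreLie K A) (R : HomPreLieRep K A V P)
    (θ : A →ₗ[K] A →ₗ[K] V) (ξ : A →ₗ[K] V)
    -- the first 2-cocycle identity:
    (hcocycle1 : ∀ x y z : A,
      R.ρ (P.hom x) (θ y z) - R.ρ (P.hom y) (θ x z)
        + R.μ (P.hom z) (θ y x) - R.μ (P.hom z) (θ x y)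
        + θ (P.hom x) (P.mul y z) - θ (P.hom y) (P.mul x z)
        - θ (P.mul x y - P.mul y x) (P.hom z)
        - R.ρ (P.mul x y - P.mul y x) (ξ z)
        - R.μ (P.mul x z) (ξ y) + R.μ (P.mul y z) (ξ x) = 0)
    -- the second 2-cocycle identity:
    (hcocycle2 : ∀ x y : A,
      R.β (θ x y) - θ (P.hom x) (P.hom y)
        - R.ρ (P.hom x) (ξ y) - R.μ (P.hom y) (ξ x) + ξ (P.mul x y) = 0) :
    ∃ Q : HomPreLie K (A × V),
      -- the multiplication `⋄`:
      (∀ (x y : A) (u v : V),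
        Q.mul (x, u) (y, v) = (P.mul x y, θ x y + R.ρ x v + R.μ y u))
      -- the structure map `φ`:
      ∧ (∀ (x : A) (u : V), Q.hom (x, u) = (P.hom x, ξ x + R.β u))
      -- the inclusion of `V` is a morphism from the abelian algebra `(V,0,β)`:
      ∧ (∀ u v : V, Q.mul ((0 : A), u) ((0 : A), v) = 0)
      ∧ (∀ u : V, Q.hom ((0 : A), u) = ((0 : A), R.β u))
      -- the projection onto `A` is a morphism of Hom-pre-Lie algebras:
      ∧ (∀ a b : A × V, (Q.mul a b).1 = P.mul a.1 b.1)
      ∧ (∀ a : A × V, (Q.hom a).1 = P.hom a.1)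
      -- short exactness of `0 → V → A ⊕ V → A → 0`:
      ∧ Function.Injective (fun u : V => ((0 : A), u))
      ∧ Function.Surjective (fun a : A × V => a.1)
      ∧ (∀ a : A × V, a.1 = 0 ↔ a ∈ Set.range (fun u : V => ((0 : A), u))) := by
  refine ⟨⟨R.extMul θ, R.extHom ξ, ?_, ?_⟩, ?_⟩
  · rintro ⟨x, u⟩ ⟨y, v⟩
    ext
    · simp [HomPreLieRep.extMul, HomPreLieRep.extHom, P.hom_mul]
    · simp only [HomPreLieRep.extMul, HomPreLieRep.extHom, LinearMap.mk₂_apply,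
        LinearMap.prod_apply, Function.prod_apply, LinearMap.comp_apply, LinearMap.fst_apply,
        LinearMap.coprod_apply, map_add, R.β_ρ, R.β_μ]
      linear_combination (norm := module) hcocycle2 x y
  · rintro ⟨x, u⟩ ⟨y, v⟩ ⟨z, w⟩
    ext
    · simpa [HomPreLieRep.extMul, HomPreLieRep.extHom] using P.pre_lie x y z
    · have hc := hcocycle1 x y z
      have hρ := R.ρ_bracket x y w
      have hx := R.μ_mul x z v
      have hy := R.μ_mul y z u
      simp only [HomPreLieRep.extMul, HomPreLieRep.extHom, LinearMap.mk₂_apply,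
        LinearMap.prod_apply, Function.prod_apply, LinearMap.comp_apply, LinearMap.fst_apply,
        LinearMap.coprod_apply, map_add, map_sub, LinearMap.sub_apply,
        Prod.snd_sub] at hc hρ hx hy ⊢
      linear_combination (norm := module) hρ - hc + hy - hx
  · refine ⟨fun _ _ _ _ => rfl, fun _ _ => rfl, fun _ _ => ?_, fun _ => ?_, fun _ _ => rfl,
      fun _ => rfl, Prod.mk_right_injective 0, Prod.fst_surjective, ?_⟩
    · simp [HomPreLieRep.extMul]
    · simp [HomPreLieRep.extHom]
    · rintro ⟨x, u⟩
      simp [eq_comm]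
end

section
/- Let (A,·,α) be a Hom-pre-Lie algebra, (V,β,ρ,μ) a representation of it, and (θ_1,ξ_1), (θ_2,ξ_2) two 2-cocycles of (A,·,α) with coefficients in (V,β,ρ,μ) which are cohomologous: there is a linear map φ : A → V with θ_1(x,y) = θ_2(x,y) + ρ(x)φ(y) + μ(y)φ(x) − φ(x·y) and ξ_1(x) = ξ_2(x) + β(φ(x)) − φ(α(x)) for all x,y ∈ A. Let (A ⊕ V, ⋄_1, φ_1) and (A ⊕ V, ⋄_2, φ_2) be the abelian extensions they determine, where (x+u) ⋄_i (y+v) = x·y + θ_i(x,y) + ρ(x)(v) + μ(y)(u) and φ_i(x+u) = α(x) + ξ_i(x) + β(u). Then the map ζ : A ⊕ V → A ⊕ V, ζ(x+u) = x + u + φ(x), is an isomorphism of Hom-pre-Lie algebras from (A ⊕ V, ⋄_1, φ_1) to (A ⊕ V, ⋄_2, φ_2) which restricts to the identity on V and induces the identity on A; in particular the two abelian extensions are isomorphic. -/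
/-- Cohomologous 2-cocycles give isomorphic abelian extensions: if
`(θ₁,ξ₁)` and `(θ₂,ξ₂)` are 2-cocycles of `(A,·,α)` with coefficients in
`(V,β,ρ,μ)` differing by the 2-coboundary of `φ : A → V`, and
`(A ⊕ V, ⋄₁, φ₁)`, `(A ⊕ V, ⋄₂, φ₂)` are the abelian extensions they
determine, then `ζ(x+u) = x + u + φ(x)` is an isomorphism of Hom-pre-Lie
algebras from the first to the second which restricts to the identity on `V`
and induces the identity on `A`. -/
theorem cohomologous_cocycles_isomorphic_extensions
    (K : Type*) [Field K] (A : Type*) [AddCommGroup A] [Module K A]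
    (V : Type*) [AddCommGroup V] [Module K V]
    (P : HomPreLie K A) (R : HomPreLieRep K A V P)
    (θ₁ θ₂ : A →ₗ[K] A →ₗ[K] V) (ξ₁ ξ₂ : A →ₗ[K] V)
    -- `(θ₁,ξ₁)` is a 2-cocycle:
    (hcocycle1₁ : ∀ x y z : A,
      R.ρ (P.hom x) (θ₁ y z) - R.ρ (P.hom y) (θ₁ x z)
        + R.μ (P.hom z) (θ₁ y x) - R.μ (P.hom z) (θ₁ x y)
        + θ₁ (P.hom x) (P.mul y z) - θ₁ (P.hom y) (P.mul x z)
        - θ₁ (P.mul x y - P.mul y x) (P.hom z)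
        - R.ρ (P.mul x y - P.mul y x) (ξ₁ z)
        - R.μ (P.mul x z) (ξ₁ y) + R.μ (P.mul y z) (ξ₁ x) = 0)
    (hcocycle2₁ : ∀ x y : A,
      R.β (θ₁ x y) - θ₁ (P.hom x) (P.hom y)
        - R.ρ (P.hom x) (ξ₁ y) - R.μ (P.hom y) (ξ₁ x) + ξ₁ (P.mul x y) = 0)
    -- `(θ₂,ξ₂)` is a 2-cocycle:
    (hcocycle1₂ : ∀ x y z : A,
      R.ρ (P.hom x) (θ₂ y z) - R.ρ (P.hom y) (θ₂ x z)
        + R.μ (P.hom z) (θ₂ y x) - R.μ (P.hom z) (θ₂ x y)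
        + θ₂ (P.hom x) (P.mul y z) - θ₂ (P.hom y) (P.mul x z)
        - θ₂ (P.mul x y - P.mul y x) (P.hom z)
        - R.ρ (P.mul x y - P.mul y x) (ξ₂ z)
        - R.μ (P.mul x z) (ξ₂ y) + R.μ (P.mul y z) (ξ₂ x) = 0)
    (hcocycle2₂ : ∀ x y : A,
      R.β (θ₂ x y) - θ₂ (P.hom x) (P.hom y)
        - R.ρ (P.hom x) (ξ₂ y) - R.μ (P.hom y) (ξ₂ x) + ξ₂ (P.mul x y) = 0)
    -- the two 2-cocycles are cohomologous via `φ`: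
    (φ : A →ₗ[K] V)
    (hθ : ∀ x y : A,
      θ₁ x y = θ₂ x y + R.ρ x (φ y) + R.μ y (φ x) - φ (P.mul x y))
    (hξ : ∀ x : A, ξ₁ x = ξ₂ x + R.β (φ x) - φ (P.hom x))
    -- the two abelian extensions they determine:
    (Q₁ Q₂ : HomPreLie K (A × V))
    (hQ₁mul : ∀ (x y : A) (u v : V),
      Q₁.mul (x, u) (y, v) = (P.mul x y, θ₁ x y + R.ρ x v + R.μ y u))
    (hQ₁hom : ∀ (x : A) (u : V), Q₁.hom (x, u) = (P.hom x, ξ₁ x + R.β u))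
    (hQ₂mul : ∀ (x y : A) (u v : V),
      Q₂.mul (x, u) (y, v) = (P.mul x y, θ₂ x y + R.ρ x v + R.μ y u))
    (hQ₂hom : ∀ (x : A) (u : V), Q₂.hom (x, u) = (P.hom x, ξ₂ x + R.β u)) :
    -- `ζ(x+u) = x + u + φ(x)` is an isomorphism of abelian extensions:
    ∃ ζ : (A × V) ≃ₗ[K] (A × V),
      (∀ (x : A) (u : V), ζ (x, u) = (x, u + φ x))
      -- `ζ` is a morphism of Hom-pre-Lie algebras:
      ∧ (∀ a b : A × V, ζ (Q₁.mul a b) = Q₂.mul (ζ a) (ζ b))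
      ∧ (∀ a : A × V, ζ (Q₁.hom a) = Q₂.hom (ζ a))
      -- `ζ` restricts to the identity on `V`:
      ∧ (∀ u : V, ζ ((0 : A), u) = ((0 : A), u))
      -- `ζ` induces the identity on `A`:
      ∧ (∀ a : A × V, (ζ a).1 = a.1) := by
  refine ⟨(LinearEquiv.refl K A).skewProd (LinearEquiv.refl K V) φ,
    fun x u => by simp, ?_, ?_, fun u => by simp, fun a => by simp⟩
  · rintro ⟨x, u⟩ ⟨y, v⟩
    simp only [LinearEquiv.skewProd_apply, LinearEquiv.refl_apply, hQ₁mul, hQ₂mul, hθ, map_add]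
    congr 1
    abel
  · rintro ⟨x, u⟩
    simp only [LinearEquiv.skewProd_apply, LinearEquiv.refl_apply, hQ₁hom, hQ₂hom, hξ, map_add]
    congr 1
    abel
end
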